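/- arXiv:1703.00702 — 3 statements merged into one kernel-verified Lean document; each statement's English description precedes it below -/
import Mathlib

section
/- Let k be a field and n ≥ 1 a natural number. For every matrix A ∈ GL_n(k((t))) (invertible n×n matrix over the field of formal Laurent series) there exist a matrix U ∈ GL_n(k((t))) such that all entries of U and of U⁻¹ lie in the k-subalgebra of k((t)) generated by t⁻¹, a matrix V ∈ GL_n(k((t))) such that all entries of V and of V⁻¹ lie in the subring k[[t]] of formal power series, and a nonincreasing sequence of integers a₁ ≥ a₂ ≥ … ≥ a_n, such that A = U · diag(t^{a₁}, …, t^{a_n}) · V. (This is the Birkhoff decomposition G(k[t⁻¹])\G(k((t)))/G(k[[t]]) ≅ X_*(A)_+ of the paper's final theorem in the case G = GL_n, where the dominant cocharacters of the diagonal maximal torus correspond to nonincreasing integer sequences.) -/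
open Matrix

theorem Matrix.det_updateRow_linearCombination {R n : Type*} [CommRing R] [Fintype n]
    [DecidableEq n] (M : Matrix n n R) (r : n → R) (i : n) :
    (M.updateRow i fun j => ∑ l, r l * M l j).det = r i * M.det := by
  rw [← smul_eq_mul, ← det_updateRow_sum]
  congr 2
  ext j
  simp

open HahnSeries in
theorem LaurentSeries.single_mem_adjoin_single_neg_one (k : Type*) [Field k] {m : ℤ} (hm : m ≤ 0)
    (c : k) : (single m c : LaurentSeries k) ∈
      Algebra.adjoin k {(single (-1 : ℤ) (1 : k) : LaurentSeries k)} := by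
  obtain ⟨d, rfl⟩ : ∃ d : ℕ, m = -(d : ℤ) := ⟨m.natAbs, by omega⟩
  have h : (single (-(d : ℤ)) c : LaurentSeries k) =
      algebraMap k (LaurentSeries k) c * (single (-1 : ℤ) (1 : k)) ^ d := by
    rw [single_pow, LaurentSeries.algebraMap_apply, C_apply, single_mul_single]
    simp
  rw [h]
  exact Subalgebra.mul_mem _ (Subalgebra.algebraMap_mem _ c)
    (Subalgebra.pow_mem _ (Algebra.self_mem_adjoin_singleton k _) d)

open HahnSeries in
theorem LaurentSeries.exists_eq_single_mul_ofPowerSeries {k : Type*} [Field k]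
    (f : LaurentSeries k) {m : ℤ} (hm : m ≤ f.order) :
    ∃ p : PowerSeries k, f = single m 1 * ofPowerSeries ℤ k p := by
  refine ⟨PowerSeries.X ^ (f.order - m).toNat * f.powerSeriesPart, ?_⟩
  rw [map_mul, map_pow, ofPowerSeries_X, single_pow, ← mul_assoc, single_mul_single]
  conv_lhs => rw [← LaurentSeries.single_order_mul_powerSeriesPart f]
  congr 2
  · rw [nsmul_one, Int.toNat_of_nonneg (sub_nonneg.2 hm), add_sub_cancel]
  · simp

open HahnSeries in
/-- A partial Birkhoff form of `A`: a matrix `U` of determinant `1` over `k[t⁻¹]` and a power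
series matrix `W` with `U * A = diag(t^aᵢ) * W`. -/
def LaurentSeries.IsRowReduction {k : Type*} [Field k] {n : ℕ}
    (A : Matrix (Fin n) (Fin n) (LaurentSeries k))
    (U : Matrix (Fin n) (Fin n) (Algebra.adjoin k {(single (-1 : ℤ) (1 : k) : LaurentSeries k)}))
    (a : Fin n → ℤ) (W : Matrix (Fin n) (Fin n) (PowerSeries k)) : Prop :=
  U.det = 1 ∧ ∀ i j, ∑ l, (U i l : LaurentSeries k) * A l j =
    single (a i) 1 * ofPowerSeries ℤ k (W i j)

namespace LaurentSeries.IsRowReduction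

open HahnSeries

variable {k : Type*} [Field k] {n : ℕ} {A : Matrix (Fin n) (Fin n) (LaurentSeries k)}
  {U : Matrix (Fin n) (Fin n) (Algebra.adjoin k {(single (-1 : ℤ) (1 : k) : LaurentSeries k)})}
  {a : Fin n → ℤ} {W : Matrix (Fin n) (Fin n) (PowerSeries k)}

theorem exists_one (A : Matrix (Fin n) (Fin n) (LaurentSeries k)) :
    ∃ a W, IsRowReduction A 1 a W := by
  obtain ⟨m, hm⟩ := (Set.finite_range fun p : Fin n × Fin n => (A p.1 p.2).order).bddBelow
  have h (i j : Fin n) : m ≤ (A i j).order := hm ⟨(i, j), rfl⟩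
  choose W hW using fun i j => exists_eq_single_mul_ofPowerSeries (A i j) (h i j)
  refine ⟨fun _ => m, W, det_one, fun i j => ?_⟩
  rw [← hW, Finset.sum_eq_single i] <;> simp +contextual [eq_comm]

theorem map_mul_eq (h : IsRowReduction A U a W) :
    U.map (Subalgebra.val _) * A =
      diagonal (fun i => single (a i) (1 : k)) * W.map (ofPowerSeries ℤ k) := by
  ext1 i j
  rw [diagonal_mul, mul_apply]
  exact h.2 i j

theorem det_map (h : IsRowReduction A U a W) :
    (U.map (Subalgebra.val _)).det = 1 := by
  have := (AlgHom.map_det (Subalgebra.val _) U).symm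
  exact this.trans (by rw [h.1]; rfl)

theorem sum_le_order_det (h : IsRowReduction A U a W) (hA : A.det ≠ 0) :
    ∑ i, a i ≤ A.det.order := by
  have hs (s : Finset (Fin n)) :
      ∏ i ∈ s, (single (a i) (1 : k) : LaurentSeries k) = single (∑ i ∈ s, a i) 1 := by
    induction s using Finset.induction_on with
    | empty => simp
    | insert i s hi ih => rw [Finset.prod_insert hi, Finset.sum_insert hi, ih, single_mul_single,
        mul_one]
  have hd := congrArg Matrix.det h.map_mul_eq
  have hW := (RingHom.map_det (ofPowerSeries ℤ k) W).symm
  rw [RingHom.mapMatrix_apply] at hW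
  rw [det_mul, det_mul, h.det_map, one_mul, det_diagonal, hs, hW] at hd
  rw [hd] at hA ⊢
  rw [order_mul (left_ne_zero_of_mul hA) (right_ne_zero_of_mul hA), order_single one_ne_zero,
    le_add_iff_nonneg_right]
  refine (le_order_iff_forall (right_ne_zero_of_mul hA)).2 fun j hj => ?_
  rw [ofPowerSeries_apply]
  refine embDomain_of_notMem_range ?_
  rintro ⟨x, rfl⟩
  exact absurd hj (by simp)

theorem exists_sum_lt (h : IsRowReduction A U a W) (hW : ¬ IsUnit W.det) :
    ∃ U' a' W', IsRowReduction A U' a' W' ∧ ∑ i, a i < ∑ i, a' i := by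
  have hdet : (W.map PowerSeries.constantCoeff).det = 0 := by
    have := (RingHom.map_det (PowerSeries.constantCoeff (R := k)) W).symm
    rw [RingHom.mapMatrix_apply] at this
    rwa [this, ← not_ne_iff, ← isUnit_iff_ne_zero, ← PowerSeries.isUnit_iff_constantCoeff]
  obtain ⟨c, hc, hcW⟩ := exists_vecMul_eq_zero_iff.2 hdet
  classical
  obtain ⟨i, hi, hmin⟩ : ∃ i, c i ≠ 0 ∧ ∀ j, c j ≠ 0 → a i ≤ a j := by
    obtain ⟨i₀, hi₀⟩ := Function.ne_iff.1 hc
    obtain ⟨i, hi, h⟩ := (Finset.univ.filter fun j => c j ≠ 0).exists_min_image a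
      ⟨i₀, by simpa using hi₀⟩
    exact ⟨i, by simpa using hi, fun j hj => h j (by simpa using hj)⟩
  have hr (j : Fin n) : (single (a i - a j) ((c i)⁻¹ * c j) : LaurentSeries k) ∈
      Algebra.adjoin k {(single (-1 : ℤ) (1 : k) : LaurentSeries k)} := by
    by_cases hj : c j = 0
    · simp [hj]
    · exact single_mem_adjoin_single_neg_one k (sub_nonpos.2 (hmin j hj)) _
  have hX (j : Fin n) : PowerSeries.X ∣ ∑ l, PowerSeries.C ((c i)⁻¹ * c l) * W l j := by
    have := congrFun hcW j
    rw [PowerSeries.X_dvd_iff, map_sum]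
    simp only [map_mul, PowerSeries.constantCoeff_C, mul_assoc, ← Finset.mul_sum]
    simp only [vecMul, dotProduct, map_apply, Pi.zero_apply] at this
    rw [this, mul_zero]
  choose w hw using hX
  refine ⟨U.updateRow i fun j => ∑ l, ⟨_, hr l⟩ * U l j,
    Function.update a i (a i + 1), W.updateRow i w, ⟨?_, fun j l => ?_⟩, ?_⟩
  · rw [det_updateRow_linearCombination, h.1, mul_one]
    ext1
    simp [hi]
  · by_cases hj : j = i
    · subst hj
      have hwl := congrArg (ofPowerSeries ℤ k) (hw l)
      rw [map_mul, ofPowerSeries_X, map_sum] at hwl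
      simp only [updateRow_self, Function.update_self]
      have hs : (single (a j + 1) 1 : LaurentSeries k) = single (a j) 1 * single 1 1 := by
        rw [single_mul_single, mul_one]
      rw [hs, mul_assoc, ← hwl, Finset.mul_sum]
      simp only [AddSubmonoidClass.coe_finsetSum, MulMemClass.coe_mul, Finset.sum_mul]
      rw [Finset.sum_comm]
      refine Finset.sum_congr rfl fun m _ => ?_
      simp only [mul_assoc]
      rw [← Finset.mul_sum, h.2 m l, map_mul (ofPowerSeries ℤ k), ofPowerSeries_C,
        ← mul_assoc, ← mul_assoc,
        single_mul_single, C_apply, single_mul_single]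
      simp
    · simpa [hj] using h.2 j l
  · refine Finset.sum_lt_sum (fun j _ => ?_) ⟨i, Finset.mem_univ i, by simp⟩
    by_cases hj : j = i
    · subst hj; simp
    · simp [hj]

theorem exists_isUnit_det (hA : A.det ≠ 0) :
    ∃ U a W, IsRowReduction A U a W ∧ IsUnit W.det := by
  obtain ⟨a₀, W₀, h₀⟩ := exists_one A
  obtain ⟨s, ⟨U, a, W, h, rfl⟩, hs⟩ := Int.exists_greatest_of_bdd
    (P := fun s => ∃ U a W, IsRowReduction A U a W ∧ ∑ i, a i = s)
    ⟨A.det.order, by rintro _ ⟨U, a, W, h, rfl⟩; exact h.sum_le_order_det hA⟩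
    ⟨_, _, a₀, W₀, h₀, rfl⟩
  refine ⟨U, a, W, h, ?_⟩
  by_contra hW
  obtain ⟨U', a', W', h', hlt⟩ := h.exists_sum_lt hW
  exact hlt.not_ge (hs _ ⟨U', a', W', h', rfl⟩)

end LaurentSeries.IsRowReduction

/-- A matrix with a given inverse, with its rows permuted, as an element of `GL n R`. -/
def Matrix.GeneralLinearGroup.submatrixOfMul {R : Type*} [CommRing R] {n : Type*} [Fintype n]
    [DecidableEq n] (M N : Matrix n n R) (hMN : M * N = 1) (σ : Equiv.Perm n) : GL n R where
  val := M.submatrix σ id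
  inv := N.submatrix id σ
  val_inv := by
    rw [← Equiv.coe_refl, submatrix_mul_equiv, hMN, submatrix_one_equiv]
  inv_val := by
    rw [submatrix_mul_equiv, mul_eq_one_comm.1 hMN, submatrix_id_id]

/-- **Birkhoff decomposition of `GL_n(k((t)))`.**
Every invertible matrix over the field of formal Laurent series `k((t))` factors as
`U * diag(t^aᵢ) * V` where `U, U⁻¹` have entries in the `k`-subalgebra generated by `t⁻¹`,
`V, V⁻¹` have entries in the power series subring `k[[t]]`, and `a` is a nonincreasing
sequence of integers.  Here `t^m` is the Laurent series `HahnSeries.single m 1`. -/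
theorem birkhoff_decomposition_GL_laurentSeries
    (k : Type*) [Field k] (n : ℕ) (hn : 1 ≤ n)
    (A : GL (Fin n) (LaurentSeries k)) :
    ∃ (U V : GL (Fin n) (LaurentSeries k)) (a : Fin n → ℤ),
      (∀ i j : Fin n, (U : Matrix (Fin n) (Fin n) (LaurentSeries k)) i j ∈
        Algebra.adjoin k {(HahnSeries.single (-1 : ℤ) (1 : k) : LaurentSeries k)}) ∧
      (∀ i j : Fin n, ((U⁻¹ : GL (Fin n) (LaurentSeries k)) :
          Matrix (Fin n) (Fin n) (LaurentSeries k)) i j ∈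
        Algebra.adjoin k {(HahnSeries.single (-1 : ℤ) (1 : k) : LaurentSeries k)}) ∧
      (∀ i j : Fin n, (V : Matrix (Fin n) (Fin n) (LaurentSeries k)) i j ∈
        (HahnSeries.ofPowerSeries ℤ k).range) ∧
      (∀ i j : Fin n, ((V⁻¹ : GL (Fin n) (LaurentSeries k)) :
          Matrix (Fin n) (Fin n) (LaurentSeries k)) i j ∈
        (HahnSeries.ofPowerSeries ℤ k).range) ∧
      Antitone a ∧
      (A : Matrix (Fin n) (Fin n) (LaurentSeries k)) =
        (U : Matrix (Fin n) (Fin n) (LaurentSeries k)) *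
          Matrix.diagonal (fun i => (HahnSeries.single (a i) (1 : k) : LaurentSeries k)) *
          (V : Matrix (Fin n) (Fin n) (LaurentSeries k)) := by
  obtain ⟨U, a, W, h, hW⟩ := LaurentSeries.IsRowReduction.exists_isUnit_det
    (A := (A : Matrix (Fin n) (Fin n) (LaurentSeries k))) (A.isUnit.map detMonoidHom).ne_zero
  let σ : Equiv.Perm (Fin n) := Tuple.sort (OrderDual.toDual ∘ a)
  have hU : U * U.adjugate = 1 := by rw [mul_adjugate, h.1, one_smul]
  have hUL := (map_mul (Subalgebra.val _).mapMatrix U U.adjugate).symm.trans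
    ((congrArg (Subalgebra.val _).mapMatrix hU).trans (map_one _))
  have hWL := congrArg (HahnSeries.ofPowerSeries ℤ k).mapMatrix (mul_nonsing_inv W hW)
  rw [map_mul, map_one] at hWL
  refine ⟨(GeneralLinearGroup.submatrixOfMul _ _ hUL σ)⁻¹,
    GeneralLinearGroup.submatrixOfMul _ _ hWL σ, a ∘ σ, fun i j => Subtype.property _,
    fun i j => ?_, fun i j => ⟨_, rfl⟩, fun i j => ⟨_, rfl⟩,
    fun i j hij => Tuple.monotone_sort (OrderDual.toDual ∘ a) hij, ?_⟩
  · rw [inv_inv]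
    exact Subtype.property _
  · rw [mul_assoc, Units.eq_inv_mul_iff_mul_eq]
    ext1 i j
    rw [diagonal_mul, mul_apply]
    exact h.2 (σ i) j
end

section
/- Let k be a field and n ≥ 1 a natural number. Suppose a matrix A ∈ GL_n(k((t))) admits two factorizations A = U · diag(t^{a₁}, …, t^{a_n}) · V = U′ · diag(t^{b₁}, …, t^{b_n}) · V′, where a₁ ≥ … ≥ a_n and b₁ ≥ … ≥ b_n are nonincreasing sequences of integers, U and U′ (together with their inverses) have entries in the k-subalgebra of k((t)) generated by t⁻¹, and V and V′ (together with their inverses) have entries in k[[t]]. Then a_i = b_i for all i = 1, …, n; moreover, the common sum a₁ + … + a_n equals the t-adic valuation of det(A). (Uniqueness of the dominant cocharacter in the Birkhoff decomposition of GL_n(k((t))).) -/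
open Matrix

section BirkhoffUniqueness

/-- A determinant with a zero block of rows `≤ m` and columns `≥ m` vanishes. -/
theorem Matrix.det_eq_zero_of_corner {R : Type*} [CommRing R] {n : ℕ}
    (P : Matrix (Fin n) (Fin n) R) (m : Fin n)
    (h : ∀ i j, i ≤ m → m ≤ j → P i j = 0) : P.det = 0 := by
  rw [← Matrix.det_transpose, Matrix.det_apply]
  refine Finset.sum_eq_zero fun σ _ => ?_
  obtain ⟨i, hi, hσ⟩ : ∃ i, i ≤ m ∧ m ≤ σ i := by
    by_contra! hlt
    have hcard := Finset.card_le_card_of_injOn (s := Finset.Iic m) (t := Finset.Iio m) σ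
      (fun i hi => by simpa using hlt i (by simpa using hi)) σ.injective.injOn
    simp at hcard
  rw [Finset.prod_eq_zero (Finset.mem_univ i) (by simpa using h i (σ i) hi hσ), smul_zero]

theorem Matrix.det_mem_of_forall_mem {ι R : Type*} [Fintype ι] [DecidableEq ι] [CommRing R]
    (S : Subring R) (M : Matrix ι ι R) (h : ∀ i j, M i j ∈ S) : M.det ∈ S := by
  rw [Matrix.det_apply]
  exact sum_mem fun σ _ => by
    rw [Units.smul_def]
    exact zsmul_mem (prod_mem fun i _ => h _ _) _

variable {k : Type*} [Field k]

theorem LaurentSeries.coeff_eq_zero_of_mem_adjoin {x : LaurentSeries k}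
    (hx : x ∈ Algebra.adjoin k {(HahnSeries.single (-1 : ℤ) (1 : k) : LaurentSeries k)})
    {d : ℤ} (hd : 0 < d) : x.coeff d = 0 := by
  induction hx using Algebra.adjoin_induction generalizing d with
  | mem x hx =>
    rw [Set.mem_singleton_iff.1 hx]
    exact HahnSeries.coeff_single_of_ne (by lia)
  | algebraMap r =>
    rw [LaurentSeries.algebraMap_apply]
    exact HahnSeries.coeff_single_of_ne (by lia)
  | add x y _ _ hx hy => rw [HahnSeries.coeff_add, hx hd, hy hd, add_zero]
  | mul x y _ _ hx hy =>
    rw [HahnSeries.coeff_mul]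
    refine Finset.sum_eq_zero fun p hp => ?_
    have hp := (Finset.mem_antidiagonal.1 hp).2.2
    rcases lt_or_ge 0 p.1 with h | h
    · rw [hx h, zero_mul]
    · rw [hy (show 0 < p.2 by lia), mul_zero]

theorem LaurentSeries.coeff_eq_zero_of_mem_range {x : LaurentSeries k}
    (hx : x ∈ (HahnSeries.ofPowerSeries ℤ k).range) {d : ℤ} (hd : d < 0) : x.coeff d = 0 := by
  obtain ⟨f, rfl⟩ := hx
  rw [HahnSeries.ofPowerSeries_apply]
  refine HahnSeries.embDomain_of_notMem_range ?_
  rintro ⟨e, rfl⟩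
  simp at hd
  lia

theorem LaurentSeries.order_nonpos_of_mem_adjoin {x : LaurentSeries k}
    (hx : x ∈ Algebra.adjoin k {(HahnSeries.single (-1 : ℤ) (1 : k) : LaurentSeries k)}) :
    x.order ≤ 0 := by
  by_contra! h
  have hx0 : x ≠ 0 := by rintro rfl; simp at h
  exact hx0 (HahnSeries.coeff_order_eq_zero.1 (coeff_eq_zero_of_mem_adjoin hx h))

theorem LaurentSeries.order_nonneg_of_mem_range {x : LaurentSeries k}
    (hx : x ∈ (HahnSeries.ofPowerSeries ℤ k).range) : 0 ≤ x.order := by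
  by_contra! h
  have hx0 : x ≠ 0 := by rintro rfl; simp at h
  exact hx0 (HahnSeries.coeff_order_eq_zero.1 (coeff_eq_zero_of_mem_range hx h))

theorem LaurentSeries.order_det_add_order_det_inv {n : ℕ} (M : GL (Fin n) (LaurentSeries k)) :
    (M : Matrix (Fin n) (Fin n) (LaurentSeries k)).det.order +
      ((M⁻¹ : GL (Fin n) (LaurentSeries k)) :
        Matrix (Fin n) (Fin n) (LaurentSeries k)).det.order = 0 := by
  have h : (M : Matrix (Fin n) (Fin n) (LaurentSeries k)).det *
      ((M⁻¹ : GL (Fin n) (LaurentSeries k)) :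
        Matrix (Fin n) (Fin n) (LaurentSeries k)).det = 1 := by
    rw [← Matrix.det_mul, Units.mul_inv, Matrix.det_one]
  rw [← HahnSeries.order_mul (left_ne_zero_of_mul_eq_one h) (right_ne_zero_of_mul_eq_one h), h,
    HahnSeries.order_one]

theorem LaurentSeries.order_det_eq_zero_of_mem_adjoin {n : ℕ} (M : GL (Fin n) (LaurentSeries k))
    (hM : ∀ i j : Fin n, (M : Matrix (Fin n) (Fin n) (LaurentSeries k)) i j ∈
      Algebra.adjoin k {(HahnSeries.single (-1 : ℤ) (1 : k) : LaurentSeries k)})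
    (hMinv : ∀ i j : Fin n, ((M⁻¹ : GL (Fin n) (LaurentSeries k)) :
        Matrix (Fin n) (Fin n) (LaurentSeries k)) i j ∈
      Algebra.adjoin k {(HahnSeries.single (-1 : ℤ) (1 : k) : LaurentSeries k)}) :
    (M : Matrix (Fin n) (Fin n) (LaurentSeries k)).det.order = 0 := by
  have h₁ := order_nonpos_of_mem_adjoin
    (Matrix.det_mem_of_forall_mem (Algebra.adjoin k _).toSubring _ hM)
  have h₂ := order_nonpos_of_mem_adjoin
    (Matrix.det_mem_of_forall_mem (Algebra.adjoin k _).toSubring _ hMinv)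
  have h₃ := order_det_add_order_det_inv M
  lia

theorem LaurentSeries.order_det_eq_zero_of_mem_range {n : ℕ} (M : GL (Fin n) (LaurentSeries k))
    (hM : ∀ i j : Fin n, (M : Matrix (Fin n) (Fin n) (LaurentSeries k)) i j ∈
      (HahnSeries.ofPowerSeries ℤ k).range)
    (hMinv : ∀ i j : Fin n, ((M⁻¹ : GL (Fin n) (LaurentSeries k)) :
        Matrix (Fin n) (Fin n) (LaurentSeries k)) i j ∈
      (HahnSeries.ofPowerSeries ℤ k).range) :
    (M : Matrix (Fin n) (Fin n) (LaurentSeries k)).det.order = 0 := by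
  have h₁ := order_nonneg_of_mem_range (Matrix.det_mem_of_forall_mem _ _ hM)
  have h₂ := order_nonneg_of_mem_range (Matrix.det_mem_of_forall_mem _ _ hMinv)
  have h₃ := order_det_add_order_det_inv M
  lia

theorem LaurentSeries.prod_single {ι : Type*} (s : Finset ι) (a : ι → ℤ) :
    ∏ i ∈ s, (HahnSeries.single (a i) (1 : k) : LaurentSeries k) =
      HahnSeries.single (∑ i ∈ s, a i) 1 := by
  classical
  induction s using Finset.induction_on with
  | empty => simp
  | insert i s hi ih =>
    rw [Finset.prod_insert hi, Finset.sum_insert hi, ih, HahnSeries.single_mul_single, one_mul]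

/-- If `U * diag(t^aᵢ) * V = U' * diag(t^bᵢ) * V'` with `a`, `b` nonincreasing, `U` and `U'⁻¹`
over `k[t⁻¹]`, and `V⁻¹` and `V'` over `k[[t]]`, then `b ≤ a`. -/
theorem LaurentSeries.birkhoff_exponents_le {n : ℕ}
    (U V U' V' : GL (Fin n) (LaurentSeries k)) {a b : Fin n → ℤ}
    (ha : Antitone a) (hb : Antitone b)
    (hU : ∀ i j : Fin n, (U : Matrix (Fin n) (Fin n) (LaurentSeries k)) i j ∈
      Algebra.adjoin k {(HahnSeries.single (-1 : ℤ) (1 : k) : LaurentSeries k)})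
    (hU'inv : ∀ i j : Fin n, ((U'⁻¹ : GL (Fin n) (LaurentSeries k)) :
        Matrix (Fin n) (Fin n) (LaurentSeries k)) i j ∈
      Algebra.adjoin k {(HahnSeries.single (-1 : ℤ) (1 : k) : LaurentSeries k)})
    (hVinv : ∀ i j : Fin n, ((V⁻¹ : GL (Fin n) (LaurentSeries k)) :
        Matrix (Fin n) (Fin n) (LaurentSeries k)) i j ∈
      (HahnSeries.ofPowerSeries ℤ k).range)
    (hV' : ∀ i j : Fin n, (V' : Matrix (Fin n) (Fin n) (LaurentSeries k)) i j ∈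
      (HahnSeries.ofPowerSeries ℤ k).range)
    (hfac : (U : Matrix (Fin n) (Fin n) (LaurentSeries k)) *
        Matrix.diagonal (fun i => (HahnSeries.single (a i) (1 : k) : LaurentSeries k)) *
        (V : Matrix (Fin n) (Fin n) (LaurentSeries k)) =
      (U' : Matrix (Fin n) (Fin n) (LaurentSeries k)) *
        Matrix.diagonal (fun i => (HahnSeries.single (b i) (1 : k) : LaurentSeries k)) *
        (V' : Matrix (Fin n) (Fin n) (LaurentSeries k))) :
    b ≤ a := by
  intro m
  by_contra! hm
  set P : GL (Fin n) (LaurentSeries k) := U'⁻¹ * U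
  set Q : GL (Fin n) (LaurentSeries k) := V' * V⁻¹
  have hP : ∀ i j, P.val i j ∈
      Algebra.adjoin k {(HahnSeries.single (-1 : ℤ) (1 : k) : LaurentSeries k)} := fun i j => by
    rw [Units.val_mul, Matrix.mul_apply]
    exact sum_mem fun l _ => mul_mem (hU'inv i l) (hU l j)
  have hQ : ∀ i j, Q.val i j ∈ (HahnSeries.ofPowerSeries ℤ k).range := fun i j => by
    rw [Units.val_mul, Matrix.mul_apply]
    exact sum_mem fun l _ => mul_mem (hV' i l) (hVinv l j)
  have hPQ : P.val * Matrix.diagonal (fun i => (HahnSeries.single (a i) (1 : k))) =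
      Matrix.diagonal (fun i => (HahnSeries.single (b i) (1 : k))) * Q.val := by
    have h := congrArg (fun M => (U'⁻¹).val * M * (V⁻¹).val) hfac
    simpa only [P, Q, Units.val_mul, ← mul_assoc, Units.inv_mul, one_mul,
      Units.mul_inv_cancel_right] using h
  have hdet : P.val.det = 0 := by
    refine Matrix.det_eq_zero_of_corner _ m fun i j hi hj => ?_
    have hlt : a j < b i := (ha hj).trans_lt (hm.trans_le (hb hi))
    have hij := congrFun (congrFun hPQ i) j
    rw [Matrix.mul_diagonal, Matrix.diagonal_mul] at hij
    ext d
    rw [HahnSeries.coeff_zero]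
    rcases lt_or_ge 0 d with hd | hd
    · exact coeff_eq_zero_of_mem_adjoin (hP i j) hd
    · have h := congrArg (fun x : LaurentSeries k => x.coeff (d + a j)) hij
      have hq := HahnSeries.coeff_single_mul_add (r := (1 : k)) (x := Q.val i j)
        (a := d + a j - b i) (b := b i)
      rw [sub_add_cancel, coeff_eq_zero_of_mem_range (hQ i j) (by lia), mul_zero] at hq
      simpa only [HahnSeries.coeff_mul_single_add, mul_one, hq] using h
  exact ((Matrix.isUnit_iff_isUnit_det _).1 P.isUnit).ne_zero hdet

end BirkhoffUniqueness

/-- **Uniqueness of the dominant cocharacter in the Birkhoff decomposition of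
`GL_n(k((t)))`.** If a matrix `A ∈ GL_n(k((t)))` admits two factorizations
`U * diag(t^aᵢ) * V = U' * diag(t^bᵢ) * V'` with nonincreasing integer sequences `a`, `b`,
where `U, U', U⁻¹, U'⁻¹` have entries in the `k`-subalgebra generated by `t⁻¹` and
`V, V', V⁻¹, V'⁻¹` have entries in `k[[t]]`, then `a = b`; moreover `∑ aᵢ` equals the
`t`-adic valuation (`HahnSeries.order`) of `det A`. -/
theorem birkhoff_decomposition_GL_laurentSeries_unique
    (k : Type*) [Field k] (n : ℕ) (hn : 1 ≤ n)
    (A U V U' V' : GL (Fin n) (LaurentSeries k)) (a b : Fin n → ℤ)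
    (ha : Antitone a) (hb : Antitone b)
    (hU : ∀ i j : Fin n, (U : Matrix (Fin n) (Fin n) (LaurentSeries k)) i j ∈
      Algebra.adjoin k {(HahnSeries.single (-1 : ℤ) (1 : k) : LaurentSeries k)})
    (hUinv : ∀ i j : Fin n, ((U⁻¹ : GL (Fin n) (LaurentSeries k)) :
        Matrix (Fin n) (Fin n) (LaurentSeries k)) i j ∈
      Algebra.adjoin k {(HahnSeries.single (-1 : ℤ) (1 : k) : LaurentSeries k)})
    (hU' : ∀ i j : Fin n, (U' : Matrix (Fin n) (Fin n) (LaurentSeries k)) i j ∈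
      Algebra.adjoin k {(HahnSeries.single (-1 : ℤ) (1 : k) : LaurentSeries k)})
    (hU'inv : ∀ i j : Fin n, ((U'⁻¹ : GL (Fin n) (LaurentSeries k)) :
        Matrix (Fin n) (Fin n) (LaurentSeries k)) i j ∈
      Algebra.adjoin k {(HahnSeries.single (-1 : ℤ) (1 : k) : LaurentSeries k)})
    (hV : ∀ i j : Fin n, (V : Matrix (Fin n) (Fin n) (LaurentSeries k)) i j ∈
      (HahnSeries.ofPowerSeries ℤ k).range)
    (hVinv : ∀ i j : Fin n, ((V⁻¹ : GL (Fin n) (LaurentSeries k)) :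
        Matrix (Fin n) (Fin n) (LaurentSeries k)) i j ∈
      (HahnSeries.ofPowerSeries ℤ k).range)
    (hV' : ∀ i j : Fin n, (V' : Matrix (Fin n) (Fin n) (LaurentSeries k)) i j ∈
      (HahnSeries.ofPowerSeries ℤ k).range)
    (hV'inv : ∀ i j : Fin n, ((V'⁻¹ : GL (Fin n) (LaurentSeries k)) :
        Matrix (Fin n) (Fin n) (LaurentSeries k)) i j ∈
      (HahnSeries.ofPowerSeries ℤ k).range)
    (hfac : (A : Matrix (Fin n) (Fin n) (LaurentSeries k)) =
      (U : Matrix (Fin n) (Fin n) (LaurentSeries k)) *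
        Matrix.diagonal (fun i => (HahnSeries.single (a i) (1 : k) : LaurentSeries k)) *
        (V : Matrix (Fin n) (Fin n) (LaurentSeries k)))
    (hfac' : (A : Matrix (Fin n) (Fin n) (LaurentSeries k)) =
      (U' : Matrix (Fin n) (Fin n) (LaurentSeries k)) *
        Matrix.diagonal (fun i => (HahnSeries.single (b i) (1 : k) : LaurentSeries k)) *
        (V' : Matrix (Fin n) (Fin n) (LaurentSeries k))) :
    (∀ i : Fin n, a i = b i) ∧
      (∑ i : Fin n, a i) =
        ((A : Matrix (Fin n) (Fin n) (LaurentSeries k)).det).order := by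
  refine ⟨fun i => le_antisymm ?_ ?_, ?_⟩
  · exact LaurentSeries.birkhoff_exponents_le U' V' U V hb ha hU' hUinv hV'inv hV
      (hfac'.symm.trans hfac) i
  · exact LaurentSeries.birkhoff_exponents_le U V U' V' ha hb hU hU'inv hVinv hV'
      (hfac.symm.trans hfac') i
  · have hU0 := ((Matrix.isUnit_iff_isUnit_det _).1 U.isUnit).ne_zero
    have hV0 := ((Matrix.isUnit_iff_isUnit_det _).1 V.isUnit).ne_zero
    have hD0 : (HahnSeries.single (∑ i, a i) (1 : k) : LaurentSeries k) ≠ 0 :=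
      HahnSeries.single_ne_zero one_ne_zero
    rw [hfac, Matrix.det_mul, Matrix.det_mul, Matrix.det_diagonal, LaurentSeries.prod_single,
      HahnSeries.order_mul (mul_ne_zero hU0 hD0) hV0, HahnSeries.order_mul hU0 hD0,
      LaurentSeries.order_det_eq_zero_of_mem_adjoin U hU hUinv,
      LaurentSeries.order_det_eq_zero_of_mem_range V hV hVinv,
      HahnSeries.order_single one_ne_zero, zero_add, add_zero]
end

section
/- Let k be a field and n ≥ 1 a natural number. For every matrix A ∈ SL_n(k((t))) (invertible n×n matrix over the field of formal Laurent series with det A = 1) there exist a matrix U ∈ SL_n(k((t))) such that all entries of U and of U⁻¹ lie in the k-subalgebra of k((t)) generated by t⁻¹, a matrix V ∈ SL_n(k((t))) such that all entries of V and of V⁻¹ lie in the subring k[[t]] of formal power series, and a nonincreasing sequence of integers a₁ ≥ a₂ ≥ … ≥ a_n with a₁ + a₂ + … + a_n = 0, such that A = U · diag(t^{a₁}, …, t^{a_n}) · V. (This is the Birkhoff decomposition G(k[t⁻¹])\G(k((t)))/G(k[[t]]) ≅ X_*(A)_+ of the paper's final theorem in the case G = SL_n, where the dominant cocharacters of the diagonal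 maximal torus correspond to nonincreasing integer sequences summing to zero.) -/
open Matrix

section
variable {k : Type*} [Field k] {n : ℕ}

/-- The `k`-subalgebra `k[t⁻¹]` of `k((t))`. -/
noncomputable abbrev invPoly (k : Type*) [Field k] : Subalgebra k (LaurentSeries k) :=
  Algebra.adjoin k {(HahnSeries.single (-1 : ℤ) (1 : k) : LaurentSeries k)}

/-- The diagonal matrix `diag(t^{a₁}, …, t^{aₙ})` over `k((t))`. -/
noncomputable abbrev laurentDiag (k : Type*) [Field k] {n : ℕ} (a : Fin n → ℤ) :
    Matrix (Fin n) (Fin n) (LaurentSeries k) :=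
  Matrix.diagonal (fun i => (HahnSeries.single (a i) (1 : k) : LaurentSeries k))

lemma single_mem_invPoly {m : ℤ} (hm : m ≤ 0) (c : k) :
    (HahnSeries.single m c : LaurentSeries k) ∈ invPoly k := by
  obtain ⟨l, rfl⟩ := Int.exists_eq_neg_ofNat hm
  have h : (HahnSeries.single (-(l : ℤ)) c : LaurentSeries k) =
      algebraMap k (LaurentSeries k) c *
        (HahnSeries.single (-1 : ℤ) (1 : k) : LaurentSeries k) ^ l := by
    rw [LaurentSeries.algebraMap_apply]
    simp [HahnSeries.single_pow, HahnSeries.C_apply]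
  rw [h]
  exact mul_mem (Subalgebra.algebraMap_mem _ c)
    (pow_mem (Algebra.self_mem_adjoin_singleton k _) l)

lemma det_updateRow_one {S : Type*} [CommRing S] (i : Fin n) (e : Fin n → S) :
    ((1 : Matrix (Fin n) (Fin n) S).updateRow i e).det = e i := by
  have h := Matrix.det_updateRow_sum (1 : Matrix (Fin n) (Fin n) S) i e
  have h2 : ∑ j, e j • (1 : Matrix (Fin n) (Fin n) S) j = e := by
    ext l; simp [Matrix.one_apply]
  rw [h2] at h; simpa using h

lemma det_laurentDiag (a : Fin n → ℤ) :
    (laurentDiag k a).det = HahnSeries.single (∑ i, a i) (1 : k) := by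
  rw [Matrix.det_diagonal]
  generalize (Finset.univ : Finset (Fin n)) = s
  induction s using Finset.induction_on with
  | empty => simp
  | insert i s hi ih => simp [Finset.prod_insert hi, Finset.sum_insert hi, ih]

lemma exists_clear_denominators (A : Matrix (Fin n) (Fin n) (LaurentSeries k)) :
    ∃ (N : ℕ) (V : Matrix (Fin n) (Fin n) (PowerSeries k)),
      A = laurentDiag k (fun _ => -(N : ℤ)) * V.map (HahnSeries.ofPowerSeries ℤ k) := by
  obtain ⟨⟨_, N, rfl⟩, hb⟩ := IsLocalization.exist_integer_multiples_of_finite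
    (Submonoid.powers (PowerSeries.X : PowerSeries k)) (fun p : Fin n × Fin n => A p.1 p.2)
  choose V hV using hb
  refine ⟨N, Matrix.of fun i j => V (i, j), ?_⟩
  ext1 i j
  have h := hV (i, j)
  simp only [LaurentSeries.coe_algebraMap] at h
  rw [Matrix.diagonal_mul, Matrix.map_apply, Matrix.of_apply, h, Algebra.smul_def]
  simp only [LaurentSeries.coe_algebraMap, map_pow, HahnSeries.ofPowerSeries_X]
  rw [← mul_assoc, HahnSeries.single_pow]
  simp

/-- If `V` is singular modulo `t`, a row operation over `k[t⁻¹]` on `diag(t^{aᵢ}) V` raises the sum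
of the exponents by one. The row is one of minimal exponent occurring in a linear relation between
the rows of `V` modulo `t`. -/
lemma exists_row_reduction (a : Fin n → ℤ) (V : Matrix (Fin n) (Fin n) (PowerSeries k))
    (hV : PowerSeries.constantCoeff V.det = 0) :
    ∃ (E : Matrix.SpecialLinearGroup (Fin n) (invPoly k)) (b : Fin n → ℤ)
      (W : Matrix (Fin n) (Fin n) (PowerSeries k)),
      ∑ i, b i = ∑ i, a i + 1 ∧
      (E : Matrix (Fin n) (Fin n) (invPoly k)).map (algebraMap (invPoly k) (LaurentSeries k)) *
        (laurentDiag k a * V.map (HahnSeries.ofPowerSeries ℤ k)) =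
      laurentDiag k b * W.map (HahnSeries.ofPowerSeries ℤ k) := by
  classical
  rw [RingHom.map_det, ← Matrix.exists_vecMul_eq_zero_iff] at hV
  obtain ⟨c, hc0, hc⟩ := hV
  obtain ⟨i, hi, hmin⟩ := Finset.exists_min_image (Finset.univ.filter fun j => c j ≠ 0) a
    (by obtain ⟨j, hj⟩ := Function.ne_iff.1 hc0; exact ⟨j, by simpa using hj⟩)
  simp only [Finset.mem_filter, Finset.mem_univ, true_and] at hi hmin
  have hmem (j : Fin n) :
      (HahnSeries.single (a i - a j) ((c i)⁻¹ * c j) : LaurentSeries k) ∈ invPoly k := by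
    by_cases hj : c j = 0
    · simp [hj]
    · exact single_mem_invPoly (by linarith [hmin j hj]) _
  have hdvd (l : Fin n) :
      PowerSeries.X ∣ ∑ j, PowerSeries.C ((c i)⁻¹ * c j) * V j l := by
    rw [PowerSeries.X_dvd_iff]
    have := congrFun hc l
    simp only [Matrix.vecMul, dotProduct, RingHom.mapMatrix_apply, Matrix.map_apply,
      Pi.zero_apply] at this
    simp [mul_assoc, ← Finset.mul_sum, this]
  choose w hw using hdvd
  refine ⟨⟨Matrix.updateRow 1 i fun j => ⟨_, hmem j⟩, ?_⟩, Function.update a i (a i + 1),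
    V.updateRow i w, ?_, ?_⟩
  · rw [det_updateRow_one]
    ext1
    simp [hi]
  · rw [Finset.sum_update_of_mem (Finset.mem_univ i),
      ← Finset.sum_erase_add _ _ (Finset.mem_univ i), Finset.sdiff_singleton_eq_erase]
    ring
  · ext1 r l
    rw [Matrix.mul_apply]
    simp only [Matrix.diagonal_mul, Matrix.map_apply]
    by_cases hr : r = i
    · subst hr
      simp only [Matrix.updateRow_self, Function.update_self]
      have h := congrArg (HahnSeries.ofPowerSeries ℤ k) (hw l)
      simp only [map_sum, map_mul, HahnSeries.ofPowerSeries_X, HahnSeries.ofPowerSeries_C] at h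
      have h1 : (HahnSeries.single (a r + 1) (1 : k) : LaurentSeries k) =
        HahnSeries.single (a r) 1 * HahnSeries.single 1 1 := by simp
      rw [h1, mul_assoc, ← h, Finset.mul_sum]
      refine Finset.sum_congr rfl fun j _ => ?_
      rw [← mul_assoc, ← mul_assoc]
      congr 1
      change HahnSeries.single _ _ * _ = _
      simp [HahnSeries.C_apply]
    · simp [Matrix.updateRow_ne hr, Function.update_of_ne hr, Matrix.one_apply, apply_ite]

lemma det_eq_X_pow_of_laurentDiag_mul {A : Matrix (Fin n) (Fin n) (LaurentSeries k)}
    (hdet : A.det = 1) {m : ℕ} {a : Fin n → ℤ} {V : Matrix (Fin n) (Fin n) (PowerSeries k)}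
    (ha : ∑ i, a i = -(m : ℤ))
    (hA : A = laurentDiag k a * V.map (HahnSeries.ofPowerSeries ℤ k)) :
    V.det = PowerSeries.X ^ m := by
  have h := congrArg Matrix.det hA
  rw [hdet, Matrix.det_mul, det_laurentDiag, ha, ← RingHom.mapMatrix_apply,
    ← RingHom.map_det] at h
  apply HahnSeries.ofPowerSeries_injective (Γ := ℤ)
  have h2 := congrArg (HahnSeries.single (m : ℤ) (1 : k) * ·) h
  simp only [← mul_assoc, HahnSeries.single_mul_single] at h2
  simpa [HahnSeries.ofPowerSeries_X_pow] using h2.symm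

/-- Iterating the row reduction until the power series matrix has determinant one. -/
lemma exists_unsorted_birkhoff_factorization (m : ℕ)
    (A : Matrix.SpecialLinearGroup (Fin n) (LaurentSeries k)) (a : Fin n → ℤ)
    (V : Matrix (Fin n) (Fin n) (PowerSeries k)) (ha : ∑ i, a i = -(m : ℤ))
    (hA : (A : Matrix (Fin n) (Fin n) (LaurentSeries k)) =
      laurentDiag k a * V.map (HahnSeries.ofPowerSeries ℤ k)) :
    ∃ (U : Matrix.SpecialLinearGroup (Fin n) (invPoly k)) (b : Fin n → ℤ)
      (W : Matrix.SpecialLinearGroup (Fin n) (PowerSeries k)),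
      ∑ i, b i = 0 ∧
      (A : Matrix (Fin n) (Fin n) (LaurentSeries k)) =
        (U.map (algebraMap (invPoly k) (LaurentSeries k)) :
          Matrix (Fin n) (Fin n) (LaurentSeries k)) * laurentDiag k b *
        (W.map (HahnSeries.ofPowerSeries ℤ k) : Matrix (Fin n) (Fin n) (LaurentSeries k)) := by
  have hdet := det_eq_X_pow_of_laurentDiag_mul A.det_coe ha hA
  induction m generalizing A a V with
  | zero =>
    refine ⟨1, a, ⟨V, by simpa using hdet⟩, by simpa using ha, ?_⟩
    rw [map_one, Matrix.SpecialLinearGroup.coe_one, one_mul]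
    exact hA
  | succ m ih =>
    obtain ⟨E, b, W, hb, hE⟩ := exists_row_reduction a V (by simp [hdet])
    rw [← hA] at hE
    have hb' : ∑ i, b i = -(m : ℤ) := by rw [hb, ha]; push_cast; ring
    rw [← RingHom.mapMatrix_apply, ← Matrix.SpecialLinearGroup.map_apply_coe,
      ← Matrix.SpecialLinearGroup.coe_mul] at hE
    obtain ⟨U, c, W', hc, hU⟩ := ih _ b W hb' hE
      (det_eq_X_pow_of_laurentDiag_mul (Matrix.SpecialLinearGroup.det_coe _) hb' hE)
    refine ⟨E⁻¹ * U, c, W', hc, ?_⟩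
    rw [mul_assoc] at hU
    rw [map_mul, map_inv, Matrix.SpecialLinearGroup.coe_mul, mul_assoc, mul_assoc, ← hU,
      ← Matrix.SpecialLinearGroup.coe_mul, inv_mul_cancel_left]

/-- A permutation is realized by a signed permutation matrix of determinant one. -/
lemma exists_signed_permutation (hn : 1 ≤ n) (σ : Equiv.Perm (Fin n)) :
    ∃ Q : Matrix.SpecialLinearGroup (Fin n) ℤ, ∀ i j, i ≠ σ j → Q i j = 0 := by
  let s : Fin n → ℤ := Function.update 1 ⟨0, hn⟩ (Equiv.Perm.sign σ : ℤ)
  refine ⟨⟨(1 : Matrix (Fin n) (Fin n) ℤ).submatrix id σ * Matrix.diagonal s, ?_⟩, ?_⟩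
  · rw [Matrix.det_mul, Matrix.det_permute', Matrix.det_diagonal,
      Finset.prod_update_of_mem (Finset.mem_univ _)]
    simp [← Units.val_mul]
  · intro i j h
    simp [h, Matrix.mul_diagonal]

lemma exists_laurentDiag_conj (hn : 1 ≤ n) (a : Fin n → ℤ) :
    ∃ (Q : Matrix.SpecialLinearGroup (Fin n) ℤ) (b : Fin n → ℤ), Antitone b ∧
      ∑ i, b i = ∑ i, a i ∧
      laurentDiag k a = (Q.map (Int.castRingHom (LaurentSeries k)) :
          Matrix (Fin n) (Fin n) (LaurentSeries k)) * laurentDiag k b *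
        (Q⁻¹.map (Int.castRingHom (LaurentSeries k)) :
          Matrix (Fin n) (Fin n) (LaurentSeries k)) := by
  let σ := Tuple.sort (-a)
  obtain ⟨Q, hQ⟩ := exists_signed_permutation hn σ
  refine ⟨Q, a ∘ σ, ?_, Equiv.sum_comp σ a, ?_⟩
  · intro i j hij
    simpa using Tuple.monotone_sort (-a) hij
  · have h : (Q.map (Int.castRingHom (LaurentSeries k)) :
        Matrix (Fin n) (Fin n) (LaurentSeries k)) * laurentDiag k (a ∘ σ) =
        laurentDiag k a * Q.map (Int.castRingHom (LaurentSeries k)) := by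
      ext1 i j
      rw [Matrix.mul_diagonal, Matrix.diagonal_mul]
      by_cases hij : i = σ j
      · subst hij
        simp [mul_comm]
      · simp [hQ i j hij]
    rw [h, mul_assoc, ← Matrix.SpecialLinearGroup.coe_mul, ← map_mul]
    simp

end

/-- **Birkhoff decomposition of `SL_n(k((t)))`.**
Every matrix in `SL_n` over the field of formal Laurent series `k((t))` factors as
`U * diag(t^aᵢ) * V` with `U, V ∈ SL_n(k((t)))`, where `U, U⁻¹` have entries in the
`k`-subalgebra generated by `t⁻¹`, `V, V⁻¹` have entries in the power series subring
`k[[t]]`, and `a` is a nonincreasing sequence of integers summing to zero.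
Here `t^m` is the Laurent series `HahnSeries.single m 1`. -/
theorem birkhoff_decomposition_SL_laurentSeries
    (k : Type*) [Field k] (n : ℕ) (hn : 1 ≤ n)
    (A : Matrix.SpecialLinearGroup (Fin n) (LaurentSeries k)) :
    ∃ (U V : Matrix.SpecialLinearGroup (Fin n) (LaurentSeries k)) (a : Fin n → ℤ),
      (∀ i j : Fin n, (U : Matrix (Fin n) (Fin n) (LaurentSeries k)) i j ∈
        Algebra.adjoin k {(HahnSeries.single (-1 : ℤ) (1 : k) : LaurentSeries k)}) ∧
      (∀ i j : Fin n, ((U⁻¹ : Matrix.SpecialLinearGroup (Fin n) (LaurentSeries k)) :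
          Matrix (Fin n) (Fin n) (LaurentSeries k)) i j ∈
        Algebra.adjoin k {(HahnSeries.single (-1 : ℤ) (1 : k) : LaurentSeries k)}) ∧
      (∀ i j : Fin n, (V : Matrix (Fin n) (Fin n) (LaurentSeries k)) i j ∈
        (HahnSeries.ofPowerSeries ℤ k).range) ∧
      (∀ i j : Fin n, ((V⁻¹ : Matrix.SpecialLinearGroup (Fin n) (LaurentSeries k)) :
          Matrix (Fin n) (Fin n) (LaurentSeries k)) i j ∈
        (HahnSeries.ofPowerSeries ℤ k).range) ∧
      Antitone a ∧ (∑ i : Fin n, a i) = 0 ∧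
      (A : Matrix (Fin n) (Fin n) (LaurentSeries k)) =
        (U : Matrix (Fin n) (Fin n) (LaurentSeries k)) *
          Matrix.diagonal (fun i => (HahnSeries.single (a i) (1 : k) : LaurentSeries k)) *
          (V : Matrix (Fin n) (Fin n) (LaurentSeries k)) := by
  obtain ⟨N, V, hV⟩ := exists_clear_denominators (A : Matrix (Fin n) (Fin n) (LaurentSeries k))
  obtain ⟨U, a, W, ha, hA⟩ := exists_unsorted_birkhoff_factorization (n * N) A _ V (by simp) hV
  obtain ⟨Q, b, hb, hsum, hQ⟩ := exists_laurentDiag_conj (k := k) hn a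
  have hU : (Q.map (Int.castRingHom (LaurentSeries k))) =
      (Q.map (Int.castRingHom (invPoly k))).map (algebraMap (invPoly k) (LaurentSeries k)) := by
    ext i j; simp
  have hW : (Q⁻¹.map (Int.castRingHom (LaurentSeries k))) =
      (Q⁻¹.map (Int.castRingHom (PowerSeries k))).map (HahnSeries.ofPowerSeries ℤ k) := by
    ext1 i j
    simp only [Matrix.SpecialLinearGroup.map_apply_coe, RingHom.mapMatrix_apply, Matrix.map_apply]
    simp
  rw [hU, hW] at hQ
  refine ⟨(U * Q.map (Int.castRingHom (invPoly k))).map (algebraMap (invPoly k) (LaurentSeries k)),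
    (Q⁻¹.map (Int.castRingHom (PowerSeries k)) * W).map (HahnSeries.ofPowerSeries ℤ k), b,
    ?_, ?_, ?_, ?_, hb, hsum.trans ha, ?_⟩
  · exact fun i j => Subtype.property _
  · rw [← map_inv]
    exact fun i j => Subtype.property _
  · exact fun i j => ⟨_, rfl⟩
  · rw [← map_inv]
    exact fun i j => ⟨_, rfl⟩
  · rw [hA, hQ, map_mul, map_mul, Matrix.SpecialLinearGroup.coe_mul,
      Matrix.SpecialLinearGroup.coe_mul]
    simp only [mul_assoc]
end
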